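/- arXiv:1706.00129 — 6 statements merged into one kernel-verified Lean document; each statement's English description precedes it below -/
import Mathlib

section
/- Let a > 0, 0 ≤ r < a, and θ ∈ ℝ. Then the family m ↦ −(1/2)(r/a)^{|m|} e^{imθ}, indexed by m ∈ ℤ, is summable, and (a r cos θ − a²)/(a² + r² − 2 a r cos θ) = −1/2 − (1/2) Σ_{m ∈ ℤ} (r/a)^{|m|} e^{imθ}. -/
open Complex
open scoped Real

/-- The denominator of the Poisson kernel of the unit disk is positive inside the disk. -/
lemma poisson_denominator_pos {t : ℝ} (ht : |t| < 1) (θ : ℝ) :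
    0 < 1 + t ^ 2 - 2 * t * Real.cos θ := by
  have h : t ^ 2 < 1 := (sq_lt_one_iff_abs_lt_one t).2 ht
  have hsq : t ^ 2 * (Real.sin θ ^ 2 + Real.cos θ ^ 2) = t ^ 2 := by
    rw [Real.sin_sq_add_cos_sq, mul_one]
  by_cases hs : Real.sin θ = 0
  · rw [hs] at hsq
    have h_ne : t * Real.cos θ ≠ 1 := fun h1 => by nlinarith
    have := sq_pos_of_ne_zero (sub_ne_zero.2 h_ne)
    nlinarith
  · have := sq_pos_of_ne_zero hs
    nlinarith [sq_nonneg (t - Real.cos θ), Real.sin_sq_add_cos_sq θ]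

/-- Fourier expansion of the Poisson kernel of the unit disk. -/
lemma hasSum_poisson_kernel_fourier {t : ℝ} (ht : |t| < 1) (θ : ℝ) :
    HasSum (fun m : ℤ => (t : ℂ) ^ m.natAbs * Complex.exp (Complex.I * m * θ))
      (((1 - t ^ 2) / (1 + t ^ 2 - 2 * t * Real.cos θ) : ℝ) : ℂ) := by
  set z := Complex.exp (θ * I) with hz
  set w := Complex.exp (-θ * I) with hw
  have hzw : z * w = 1 := by rw [hz, hw, ← Complex.exp_add]; simp
  have hcos : z + w = 2 * Complex.cos θ := by rw [Complex.cos]; ring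
  have hnz : ‖(t : ℂ) * z‖ < 1 := by
    simpa [hz, Complex.norm_exp_ofReal_mul_I] using ht
  have hnw : ‖(t : ℂ) * w‖ < 1 := by
    have := Complex.norm_exp_ofReal_mul_I (-θ)
    push_cast at this
    rwa [norm_mul, hw, this, mul_one, Complex.norm_real, Real.norm_eq_abs]
  have hz0 : 1 - t * z ≠ 0 := sub_ne_zero.2 fun h => by simp [← h] at hnz
  have hw0 : 1 - t * w ≠ 0 := sub_ne_zero.2 fun h => by simp [← h] at hnw
  have h₁ := hasSum_geometric_of_norm_lt_one hnz
  have h₂ := (hasSum_geometric_of_norm_lt_one hnw).mul_left (t * w)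
  have hden : (1 - t * z) * (1 - t * w) = 1 + (t : ℂ) ^ 2 - 2 * t * Complex.cos θ := by
    linear_combination (t : ℂ) ^ 2 * hzw - t * hcos
  convert HasSum.of_nat_of_neg_add_one
    (f := fun m : ℤ => (t : ℂ) ^ m.natAbs * Complex.exp (Complex.I * m * θ))
    (m := (1 - t * z)⁻¹) (m' := t * w * (1 - t * w)⁻¹) ?_ ?_ using 1
  · push_cast
    rw [← hden]
    field_simp
    linear_combination (t : ℂ) ^ 2 * hzw
  · refine (congrArg (HasSum · _) (funext fun n => ?_)).mpr h₁
    rw [mul_pow, hz, ← Complex.exp_nat_mul, Int.natAbs_natCast]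
    push_cast
    ring_nf
  · refine (congrArg (HasSum · _) (funext fun n => ?_)).mpr h₂
    rw [← pow_succ', mul_pow, hw, ← Complex.exp_nat_mul, Int.natAbs_neg,
      show ((n : ℤ) + 1).natAbs = n + 1 by omega]
    push_cast
    ring_nf

theorem disk_kernel_fourier_series
    (a r θ : ℝ) (ha : 0 < a) (hr0 : 0 ≤ r) (hra : r < a) :
    Summable (fun m : ℤ =>
      -(1 / 2 : ℂ) * ((r / a : ℝ) : ℂ) ^ m.natAbs * Complex.exp (Complex.I * m * θ)) ∧
    (((a * r * Real.cos θ - a ^ 2) / (a ^ 2 + r ^ 2 - 2 * a * r * Real.cos θ) : ℝ) : ℂ)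
      = -(1 / 2 : ℂ)
        - (1 / 2) * ∑' m : ℤ, ((r / a : ℝ) : ℂ) ^ m.natAbs * Complex.exp (Complex.I * m * θ) := by
  have ht : |r / a| < 1 := by
    rwa [abs_of_nonneg (by positivity), div_lt_one ha]
  have h := hasSum_poisson_kernel_fourier ht θ
  refine ⟨by simpa only [mul_assoc] using h.summable.mul_left (-(1 / 2 : ℂ)), ?_⟩
  rw [h.tsum_eq]
  have hpos := poisson_denominator_pos ht θ
  have hscale : a ^ 2 + r ^ 2 - 2 * a * r * Real.cos θ
      = a ^ 2 * (1 + (r / a) ^ 2 - 2 * (r / a) * Real.cos θ) := by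
    field_simp
  have hreal : (a * r * Real.cos θ - a ^ 2) / (a ^ 2 + r ^ 2 - 2 * a * r * Real.cos θ)
      = -(1 / 2) - (1 / 2) *
        ((1 - (r / a) ^ 2) / (1 + (r / a) ^ 2 - 2 * (r / a) * Real.cos θ)) := by
    obtain ⟨t, rfl⟩ : ∃ t, r = a * t := ⟨r / a, by field_simp⟩
    rw [hscale]
    rw [mul_div_cancel_left₀ t ha.ne'] at hpos ⊢
    generalize hD : 1 + t ^ 2 - 2 * t * Real.cos θ = D at hpos ⊢
    have hne := hpos.ne'
    field_simp
    linear_combination -hD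
  rw [hreal]
  push_cast
  rfl
end

section
/- Let a > 0, r > a, and t* ∈ ℝ. Then (1/(2π)) ∫₀^{2π} (a r cos(t − t*) − a²)/(a² + r² − 2 a r cos(t − t*)) dt = 0. -/
open scoped Real

/-- The double-layer kernel of the disk of radius `a` is the real part of `z / (w - z)`, where
`z` runs over the boundary circle and `w` is the evaluation point. -/
lemma re_circleMap_div_sub (a r s t : ℝ) :
    (circleMap 0 a t / (circleMap 0 r s - circleMap 0 a t)).re =
      (a * r * Real.cos (t - s) - a ^ 2) / (a ^ 2 + r ^ 2 - 2 * a * r * Real.cos (t - s)) := by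
  have hre (R θ : ℝ) : (circleMap 0 R θ).re = R * Real.cos θ := by
    simp [circleMap, Complex.exp_ofReal_mul_I_re]
  have him (R θ : ℝ) : (circleMap 0 R θ).im = R * Real.sin θ := by
    simp [circleMap, Complex.exp_ofReal_mul_I_im]
  have hsq : Complex.normSq (circleMap 0 r s - circleMap 0 a t) =
      a ^ 2 + r ^ 2 - 2 * a * r * Real.cos (t - s) := by
    rw [Complex.normSq_apply, Complex.sub_re, Complex.sub_im, hre, hre, him, him, Real.cos_sub]
    linear_combination a ^ 2 * Real.sin_sq_add_cos_sq t + r ^ 2 * Real.sin_sq_add_cos_sq s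
  rw [Complex.div_re, hsq, ← add_div, Complex.sub_re, Complex.sub_im, hre, hre, him, him,
    Real.cos_sub]
  congr 1
  linear_combination -a ^ 2 * Real.sin_sq_add_cos_sq t

lemma diffContOnCl_div_sub {a : ℝ} {w : ℂ} (hw : a < ‖w‖) :
    DiffContOnCl ℂ (fun z : ℂ ↦ z / (w - z)) (Metric.ball 0 a) := by
  refine DifferentiableOn.diffContOnCl fun z hz ↦ ?_
  have hza : ‖z‖ ≤ a := by
    simpa using Metric.closure_ball_subset_closedBall hz
  have hne : w - z ≠ 0 := by
    rw [sub_ne_zero]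
    rintro rfl
    exact hw.not_ge hza
  exact (differentiableAt_id.div (differentiableAt_id.const_sub w) hne).differentiableWithinAt

theorem gauss_double_layer_identity_circle_exterior
    (a r tstar : ℝ) (ha : 0 < a) (hra : a < r) :
    (1 / (2 * π)) * ∫ t in (0 : ℝ)..(2 * π),
        (a * r * Real.cos (t - tstar) - a ^ 2)
          / (a ^ 2 + r ^ 2 - 2 * a * r * Real.cos (t - tstar)) = 0 := by
  set w := circleMap 0 r tstar with hw
  have hwa : |a| < ‖w‖ := by
    rw [hw, norm_circleMap_zero, abs_of_pos ha]
    exact hra.trans_le (le_abs_self r)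
  have hf := diffContOnCl_div_sub hwa
  have hint : CircleIntegrable (fun z : ℂ ↦ z / (w - z)) 0 a := by
    refine ContinuousOn.circleIntegrable' (hf.continuousOn.mono ?_)
    rw [closure_ball _ (abs_pos.mpr ha.ne').ne']
    exact Metric.sphere_subset_closedBall
  have havg := Complex.reCLM.circleAverage_comp_comm hint
  rw [hf.circleAverage] at havg
  simpa [Real.circleAverage, hw, re_circleMap_div_sub] using havg
end

section
/- Let a > 0, 0 ≤ r < a, t* ∈ ℝ, and let μ : ℝ → ℂ be continuous and 2π-periodic with Fourier coefficients μ̂[n] = (1/(2π)) ∫₀^{2π} μ(t) e^{−int} dt satisfying Σ_{n ∈ ℤ} |μ̂[n]| < ∞. Then for every k ∈ ℤ, the k-th Fourier coefficient of the function t ↦ K(t − t*) μ(t), where K(θ) = (a r cos θ − a²)/(a² + r² − 2 a r cos θ), equals −μ̂[k] − (1/2) Σ_{m=1}^{∞} (r/a)^m ( e^{i m t*} μ̂[k+m] + e^{−i m t*} μ̂[k−m] ). -/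
open Complex
open scoped Real

/-- The geometric expansion of the double-layer kernel of the disk, with `q = r / a < 1`. -/
lemma hasSum_double_layer_kernel (a r θ : ℝ) (ha : 0 < a) (hr0 : 0 ≤ r) (hra : r < a) :
    HasSum (fun m : ℕ => ((r / a : ℝ) : ℂ) ^ (m + 1)
        * (exp (I * (m + 1) * θ) + exp (-I * (m + 1) * θ)))
      (-2 - 2 * (((a * r * Real.cos θ - a ^ 2)
        / (a ^ 2 + r ^ 2 - 2 * a * r * Real.cos θ) : ℝ) : ℂ)) := by
  have hq0 : 0 ≤ r / a := by positivity
  have hq1 : r / a < 1 := (div_lt_one ha).2 hra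
  have geom (z : ℂ) (hz : ‖z‖ < 1) : HasSum (fun m : ℕ => z ^ (m + 1)) (z * (1 - z)⁻¹) := by
    simpa only [pow_succ'] using (hasSum_geometric_of_norm_lt_one hz).mul_left z
  have hn (s : ℝ) : ‖((r / a : ℝ) : ℂ) * exp (s * I)‖ < 1 := by
    rw [norm_mul, norm_exp_ofReal_mul_I, mul_one, norm_real, Real.norm_of_nonneg hq0]
    exact hq1
  have h1 := hn θ
  have h2 := hn (-θ)
  have ne (z : ℂ) (hz : ‖z‖ < 1) : 1 - z ≠ 0 := by
    intro h
    rw [← sub_eq_zero.1 h, norm_one] at hz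
    exact lt_irrefl _ hz
  have hd1 := ne _ h1
  have hd2 := ne _ h2
  convert (geom _ h1).add (geom _ h2) using 1
  · ext m
    rw [mul_pow, mul_pow, ← Complex.exp_nat_mul, ← Complex.exp_nat_mul, mul_add]
    push_cast
    ring_nf
  · have hww : exp (θ * I) * exp ((-θ : ℝ) * I) = 1 := by
      rw [← Complex.exp_add]
      simp
    have hcos : Complex.cos θ = (exp (θ * I) + exp ((-θ : ℝ) * I)) / 2 := by
      rw [Complex.cos]
      push_cast
      rfl
    have haC : (a : ℂ) ≠ 0 := ofReal_ne_zero.2 ha.ne'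
    push_cast at hd1 hd2 hww hcos ⊢
    rw [hcos]
    generalize exp (θ * I) = w at *
    generalize exp (-θ * I) = v at *
    have hden : (a : ℂ) ^ 2 + r ^ 2 - 2 * a * r * ((w + v) / 2)
        = a ^ 2 * ((1 - r / a * w) * (1 - r / a * v)) := by
      field_simp
      linear_combination -(r : ℂ) ^ 2 * hww
    have hd1' : (a : ℂ) - r * w ≠ 0 := by
      contrapose! hd1
      field_simp
      linear_combination hd1
    have hd2' : (a : ℂ) - r * v ≠ 0 := by
      contrapose! hd2
      field_simp
      linear_combination hd2
    rw [hden]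
    field_simp
    ring

theorem fourier_coefficients_of_kernel_times_density
    (a r tstar : ℝ) (ha : 0 < a) (hr0 : 0 ≤ r) (hra : r < a)
    (μ : ℝ → ℂ) (hμc : Continuous μ) (hμper : ∀ t, μ (t + 2 * π) = μ t)
    (μhat : ℤ → ℂ)
    (hμhat : ∀ n : ℤ, μhat n
      = (1 / (2 * π) : ℂ) * ∫ t in (0 : ℝ)..(2 * π), μ t * Complex.exp (-Complex.I * n * t))
    (hsum : Summable fun n : ℤ => ‖μhat n‖) :
    ∀ k : ℤ,
      (1 / (2 * π) : ℂ) * ∫ t in (0 : ℝ)..(2 * π),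
          (((a * r * Real.cos (t - tstar) - a ^ 2)
              / (a ^ 2 + r ^ 2 - 2 * a * r * Real.cos (t - tstar)) : ℝ) : ℂ)
            * μ t * Complex.exp (-Complex.I * k * t)
        = -μhat k - (1 / 2) * ∑' m : ℕ, ((r / a : ℝ) : ℂ) ^ (m + 1)
            * (Complex.exp (Complex.I * ((m : ℂ) + 1) * tstar) * μhat (k + (m + 1))
              + Complex.exp (-Complex.I * ((m : ℂ) + 1) * tstar) * μhat (k - (m + 1))) := by
  intro k
  set K : ℝ → ℝ := fun t => (a * r * Real.cos (t - tstar) - a ^ 2)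
    / (a ^ 2 + r ^ 2 - 2 * a * r * Real.cos (t - tstar)) with hK
  set e : ℝ → ℂ := fun t => μ t * exp (-I * k * t) with he
  have hq0 : 0 ≤ r / a := by positivity
  have hq1 : r / a < 1 := (div_lt_one ha).2 hra
  have hec : Continuous e := by fun_prop
  have hKc : Continuous K := by
    refine Continuous.div (by fun_prop) (by fun_prop) fun t => ne_of_gt ?_
    nlinarith [Real.cos_le_one (t - tstar), mul_nonneg ha.le hr0, sq_pos_of_pos (sub_pos.2 hra),
      mul_nonneg (mul_nonneg ha.le hr0) (sub_nonneg.2 (Real.cos_le_one (t - tstar)))]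
  have hpt (t : ℝ) := (hasSum_double_layer_kernel a r (t - tstar) ha hr0 hra).mul_right (e t)
  have hgeom : Summable fun m : ℕ => (r / a) ^ (m + 1) * 2 :=
    ((summable_nat_add_iff 1).2 (summable_geometric_of_lt_one hq0 hq1)).mul_right 2
  have hnorm (x y : ℂ) (hx : x.re = 0) (hy : y.re = 0) : ‖exp x + exp y‖ ≤ 2 := by
    refine (norm_add_le _ _).trans ?_
    rw [norm_exp, norm_exp, hx, hy, Real.exp_zero]
    norm_num
  have hint := intervalIntegral.hasSum_integral_of_dominated_convergence
    (μ := MeasureTheory.volume) (a := 0) (b := 2 * π)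
    (fun (m : ℕ) t => (r / a) ^ (m + 1) * 2 * ‖e t‖)
    (fun m => (show Continuous fun t : ℝ => ((r / a : ℝ) : ℂ) ^ (m + 1)
      * (exp (I * (m + 1) * (t - tstar : ℝ)) + exp (-I * (m + 1) * (t - tstar : ℝ))) * e t
      by fun_prop).aestronglyMeasurable)
    (fun m => Filter.Eventually.of_forall fun t _ => by
      rw [norm_mul, norm_mul, norm_pow, norm_real, Real.norm_of_nonneg hq0]
      gcongr
      exact hnorm _ _ (by simp) (by simp))
    (Filter.Eventually.of_forall fun t _ => hgeom.mul_right _)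
    (by
      simp only [tsum_mul_right]
      exact (continuous_const.mul hec.norm).intervalIntegrable _ _)
    (Filter.Eventually.of_forall fun t _ => hpt t)
  have hterm (m : ℕ) : (1 / (2 * π) : ℂ) * ∫ t in (0 : ℝ)..(2 * π), ((r / a : ℝ) : ℂ) ^ (m + 1)
      * (exp (I * (m + 1) * (t - tstar : ℝ)) + exp (-I * (m + 1) * (t - tstar : ℝ))) * e t
      = ((r / a : ℝ) : ℂ) ^ (m + 1)
        * (exp (I * (m + 1) * tstar) * μhat (k + (m + 1))
          + exp (-I * (m + 1) * tstar) * μhat (k - (m + 1))) := by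
    have hsplit (t : ℝ) : ((r / a : ℝ) : ℂ) ^ (m + 1)
        * (exp (I * (m + 1) * (t - tstar : ℝ)) + exp (-I * (m + 1) * (t - tstar : ℝ))) * e t
        = ((r / a : ℝ) : ℂ) ^ (m + 1) * exp (I * (m + 1) * tstar)
            * (μ t * exp (-I * (k + (m + 1) : ℤ) * t))
          + ((r / a : ℝ) : ℂ) ^ (m + 1) * exp (-I * (m + 1) * tstar)
            * (μ t * exp (-I * (k - (m + 1) : ℤ) * t)) := by
      have e1 : exp (I * (m + 1) * (t - tstar : ℝ)) * exp (-I * k * t)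
          = exp (-I * (m + 1) * tstar) * exp (-I * (k - (m + 1) : ℤ) * t) := by
        rw [← Complex.exp_add, ← Complex.exp_add]
        push_cast
        ring_nf
      have e2 : exp (-I * (m + 1) * (t - tstar : ℝ)) * exp (-I * k * t)
          = exp (I * (m + 1) * tstar) * exp (-I * (k + (m + 1) : ℤ) * t) := by
        rw [← Complex.exp_add, ← Complex.exp_add]
        push_cast
        ring_nf
      simp only [he]
      linear_combination ((r / a : ℝ) : ℂ) ^ (m + 1) * μ t * (e1 + e2)
    have hi (c : ℂ) (n : ℤ) : IntervalIntegrable (fun t : ℝ => c * (μ t * exp (-I * n * t)))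
        MeasureTheory.volume 0 (2 * π) :=
      Continuous.intervalIntegrable (by fun_prop) _ _
    simp only [hsplit]
    rw [intervalIntegral.integral_add (hi _ _) (hi _ _), intervalIntegral.integral_const_mul,
      intervalIntegral.integral_const_mul, hμhat, hμhat]
    ring
  have hsumK := (hint.mul_left (1 / (2 * π) : ℂ)).tsum_eq
  simp only [hterm] at hsumK
  rw [hsumK, hμhat k]
  have hsub : ∫ t in (0 : ℝ)..(2 * π), (-2 - 2 * (K t : ℂ)) * e t
      = -2 * (∫ t in (0 : ℝ)..(2 * π), e t) - 2 * ∫ t in (0 : ℝ)..(2 * π), (K t : ℂ) * e t := by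
    have hKe : Continuous fun t => (K t : ℂ) * e t := (continuous_ofReal.comp hKc).mul hec
    rw [← intervalIntegral.integral_const_mul, ← intervalIntegral.integral_const_mul,
      ← intervalIntegral.integral_sub
        (Continuous.intervalIntegrable (by fun_prop) _ _)
        (Continuous.intervalIntegrable (by fun_prop) _ _)]
    congr 1
    ext t
    ring
  have hassoc (t : ℝ) : (K t : ℂ) * μ t * exp (-I * k * t) = K t * e t := mul_assoc _ _ _
  change _ * (∫ t in (0 : ℝ)..(2 * π), (K t : ℂ) * μ t * exp (-I * k * t))
    = -(_ * ∫ t in (0 : ℝ)..(2 * π), e t)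
      - 1 / 2 * (_ * ∫ t in (0 : ℝ)..(2 * π), (-2 - 2 * (K t : ℂ)) * e t)
  simp only [hassoc]
  rw [hsub]
  ring
end

section
/- Let a > 0, 0 ≤ r < a, t* ∈ ℝ, and let μ : ℝ → ℂ be continuous and 2π-periodic with Fourier coefficients μ̂[n] satisfying Σ_{n ∈ ℤ} |μ̂[n]| < ∞. Then the double-layer potential on the disk admits the spectral representation (1/(2π)) ∫₀^{2π} K(t − t*) μ(t) dt = −(1/2) μ̂[0] − (1/2) Σ_{m ∈ ℤ} (r/a)^{|m|} μ̂[m] e^{i m t*}, where K(θ) = (a r cos θ − a²)/(a² + r² − 2 a r cos θ), and the series on the right converges absolutely. -/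
open Complex
open scoped Real

/-- The Poisson kernel expansion `∑ ρ^|m| e^{-imθ} = (1 - ρ²) / (1 + ρ² - 2 ρ cos θ)`. -/
theorem hasSum_poisson_kernel {ρ : ℝ} (h0 : 0 ≤ ρ) (h1 : ρ < 1) (θ : ℝ) :
    HasSum (fun m : ℤ => (ρ : ℂ) ^ m.natAbs * exp (-I * m * θ))
      (((1 - ρ ^ 2) / (1 + ρ ^ 2 - 2 * ρ * Real.cos θ) : ℝ) : ℂ) := by
  have norm_lt (x : ℝ) : ‖(ρ : ℂ) * exp (x * I)‖ < 1 := by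
    rwa [norm_mul, norm_exp_ofReal_mul_I, mul_one, norm_real, Real.norm_of_nonneg h0]
  have hz := norm_lt (-θ)
  have hw := norm_lt θ
  have ne_of {x : ℂ} (hx : ‖x‖ < 1) : 1 - x ≠ 0 := fun h => by
    rw [← sub_eq_zero.mp h, norm_one] at hx
    exact lt_irrefl _ hx
  have hnz := ne_of hz
  have hnw := ne_of hw
  have key := HasSum.of_nat_of_neg_add_one
    (f := fun m : ℤ => (ρ : ℂ) ^ m.natAbs * exp (-I * m * θ))
    (m := (1 - (ρ : ℂ) * exp ((-θ : ℝ) * I))⁻¹)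
    (m' := (ρ * exp (θ * I)) * (1 - (ρ : ℂ) * exp (θ * I))⁻¹)
    (by
      refine (hasSum_geometric_of_norm_lt_one hz).congr_fun fun n => ?_
      rw [mul_pow, ← exp_nat_mul, Int.natAbs_natCast]
      congr 2
      push_cast
      ring)
    (by
      refine ((hasSum_geometric_of_norm_lt_one hw).mul_left
        ((ρ : ℂ) * exp (θ * I))).congr_fun fun n => ?_
      rw [← pow_succ', mul_pow, ← exp_nat_mul,
        show (-((n : ℤ) + 1)).natAbs = n + 1 by omega]
      congr 2
      push_cast
      ring)
  convert key using 1
  have hexp : exp ((-θ : ℝ) * I) * exp (θ * I) = 1 := by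
    rw [← exp_add]
    simp
  have hcos : (2 : ℂ) * Complex.cos θ = exp (θ * I) + exp ((-θ : ℝ) * I) := by
    rw [Complex.two_cos]
    push_cast
    rfl
  have hden : (1 : ℂ) + ρ ^ 2 - 2 * ρ * Complex.cos θ
      = (1 - ρ * exp ((-θ : ℝ) * I)) * (1 - ρ * exp (θ * I)) := by
    linear_combination (-(ρ : ℂ)) * hcos - (ρ : ℂ) ^ 2 * hexp
  rw [ofReal_div]
  push_cast [-ofReal_neg]
  rw [hden]
  generalize exp ((-θ : ℝ) * I) = u at *
  generalize exp (θ * I) = v at *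
  field_simp
  linear_combination (ρ : ℂ) ^ 2 * hexp

/-- The double-layer kernel of the disk in terms of the Poisson kernel. -/
theorem double_layer_kernel_eq_poisson {a r : ℝ} (ha : 0 < a) (hr0 : 0 ≤ r) (hra : r < a)
    (θ : ℝ) :
    (a * r * Real.cos θ - a ^ 2) / (a ^ 2 + r ^ 2 - 2 * a * r * Real.cos θ)
      = -(1 / 2) - 1 / 2 *
        ((1 - (r / a) ^ 2) / (1 + (r / a) ^ 2 - 2 * (r / a) * Real.cos θ)) := by
  have hD : 0 < a ^ 2 + r ^ 2 - 2 * a * r * Real.cos θ := by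
    nlinarith [mul_nonneg (mul_nonneg ha.le hr0) (sub_nonneg.mpr (Real.cos_le_one θ)),
      pow_pos (sub_pos.mpr hra) 2]
  have hP : 1 + (r / a) ^ 2 - 2 * (r / a) * Real.cos θ
      = (a ^ 2 + r ^ 2 - 2 * a * r * Real.cos θ) / a ^ 2 := by
    field_simp
  rw [hP]
  generalize hd : a ^ 2 + r ^ 2 - 2 * a * r * Real.cos θ = d at *
  field_simp
  linear_combination -hd

/-- Absolute summability of `ρ^|m|` over the integers. -/
theorem summable_pow_natAbs {ρ : ℝ} (h0 : 0 ≤ ρ) (h1 : ρ < 1) :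
    Summable (fun m : ℤ => ρ ^ m.natAbs) := by
  have h := (hasSum_poisson_kernel h0 h1 0).summable.norm
  simpa [abs_of_nonneg h0] using h

theorem double_layer_potential_spectral_representation
    (a r tstar : ℝ) (ha : 0 < a) (hr0 : 0 ≤ r) (hra : r < a)
    (μ : ℝ → ℂ) (hμc : Continuous μ) (hμper : ∀ t, μ (t + 2 * π) = μ t)
    (μhat : ℤ → ℂ)
    (hμhat : ∀ n : ℤ, μhat n
      = (1 / (2 * π) : ℂ) * ∫ t in (0 : ℝ)..(2 * π), μ t * Complex.exp (-Complex.I * n * t))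
    (hsum : Summable fun n : ℤ => ‖μhat n‖) :
    Summable (fun m : ℤ =>
      ‖((r / a : ℝ) : ℂ) ^ m.natAbs * μhat m * Complex.exp (Complex.I * m * tstar)‖) ∧
    (1 / (2 * π) : ℂ) * ∫ t in (0 : ℝ)..(2 * π),
        (((a * r * Real.cos (t - tstar) - a ^ 2)
            / (a ^ 2 + r ^ 2 - 2 * a * r * Real.cos (t - tstar)) : ℝ) : ℂ) * μ t
      = -(1 / 2) * μhat 0
        - (1 / 2) * ∑' m : ℤ,
            ((r / a : ℝ) : ℂ) ^ m.natAbs * μhat m * Complex.exp (Complex.I * m * tstar) := by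
  have hρ0 : 0 ≤ r / a := div_nonneg hr0 ha.le
  have hρ1 : r / a < 1 := (div_lt_one ha).mpr hra
  have norm_exp_eq (m : ℤ) (x : ℝ) : ‖exp (-I * m * x)‖ = 1 := by
    rw [show -I * m * x = ((-(m * x) : ℝ) : ℂ) * I by push_cast; ring, norm_exp_ofReal_mul_I]
  refine ⟨?_, ?_⟩
  · refine Summable.of_nonneg_of_le (fun _ => norm_nonneg _) (fun m => ?_) hsum
    have he : ‖exp (I * m * tstar)‖ = 1 := by
      simpa using norm_exp_eq m (-tstar)
    rw [norm_mul, he, mul_one, norm_mul, norm_pow, norm_real, Real.norm_of_nonneg hρ0]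
    exact mul_le_of_le_one_left (norm_nonneg _) (pow_le_one₀ hρ0 hρ1.le)
  set P : ℝ → ℝ := fun θ =>
    (1 - (r / a) ^ 2) / (1 + (r / a) ^ 2 - 2 * (r / a) * Real.cos θ) with hP
  obtain ⟨C, hC⟩ := isCompact_uIcc.exists_bound_of_continuousOn
    (s := Set.uIcc (0 : ℝ) (2 * π)) hμc.continuousOn
  have hint := intervalIntegral.hasSum_integral_of_dominated_convergence
    (μ := MeasureTheory.volume) (a := (0 : ℝ)) (b := 2 * π)
    (F := fun (m : ℤ) (t : ℝ) =>
      ((r / a : ℝ) : ℂ) ^ m.natAbs * exp (-I * m * (t - tstar : ℝ)) * μ t)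
    (f := fun t => (P (t - tstar) : ℂ) * μ t)
    (fun m _ => (r / a) ^ m.natAbs * C)
    (fun m => (by fun_prop : Continuous _).aestronglyMeasurable)
    (fun m => Filter.Eventually.of_forall fun t ht => by
      rw [norm_mul, norm_mul, norm_exp_eq, mul_one, norm_pow, norm_real,
        Real.norm_of_nonneg hρ0]
      exact mul_le_mul_of_nonneg_left (hC t (Set.uIoc_subset_uIcc ht)) (pow_nonneg hρ0 _))
    (Filter.Eventually.of_forall fun t _ => (summable_pow_natAbs hρ0 hρ1).mul_right C)
    intervalIntegrable_const
    (Filter.Eventually.of_forall fun t _ =>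
      (hasSum_poisson_kernel hρ0 hρ1 (t - tstar)).mul_right (μ t))
  have hterm (m : ℤ) : (1 / (2 * π) : ℂ) * ∫ t in (0 : ℝ)..(2 * π),
      ((r / a : ℝ) : ℂ) ^ m.natAbs * exp (-I * m * (t - tstar : ℝ)) * μ t
      = ((r / a : ℝ) : ℂ) ^ m.natAbs * μhat m * exp (I * m * tstar) := by
    have : (fun t : ℝ => ((r / a : ℝ) : ℂ) ^ m.natAbs * exp (-I * m * (t - tstar : ℝ)) * μ t)
        = fun t : ℝ => (((r / a : ℝ) : ℂ) ^ m.natAbs * exp (I * m * tstar))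
          * (μ t * exp (-I * m * t)) := by
      ext t
      rw [show -I * m * (t - tstar : ℝ) = I * m * tstar + -I * m * t by push_cast; ring, exp_add]
      ring
    rw [this, intervalIntegral.integral_const_mul, hμhat m]
    ring
  have hseries := (hint.mul_left (1 / (2 * π) : ℂ)).tsum_eq
  simp only [hterm] at hseries
  have hμ0 : μhat 0 = (1 / (2 * π) : ℂ) * ∫ t in (0 : ℝ)..(2 * π), μ t := by
    simpa using hμhat 0
  have hPc : Continuous P := by
    refine continuous_const.div (by fun_prop) fun θ => ne_of_gt ?_
    nlinarith [mul_nonneg hρ0 (sub_nonneg.mpr (Real.cos_le_one θ)),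
      pow_pos (sub_pos.mpr hρ1) 2]
  have hker : (fun t : ℝ => (((a * r * Real.cos (t - tstar) - a ^ 2)
      / (a ^ 2 + r ^ 2 - 2 * a * r * Real.cos (t - tstar)) : ℝ) : ℂ) * μ t)
      = fun t => -(1 / 2) * μ t - (1 / 2) * ((P (t - tstar) : ℂ) * μ t) := by
    ext t
    rw [double_layer_kernel_eq_poisson ha hr0 hra, ofReal_sub, ofReal_mul]
    push_cast [hP]
    ring
  have hi1 : IntervalIntegrable (fun t => -(1 / 2) * μ t) MeasureTheory.volume 0 (2 * π) :=
    (by fun_prop : Continuous _).intervalIntegrable _ _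
  have hi2 : IntervalIntegrable (fun t => (1 / 2 : ℂ) * ((P (t - tstar) : ℂ) * μ t))
      MeasureTheory.volume 0 (2 * π) :=
    (by fun_prop : Continuous _).intervalIntegrable _ _
  rw [hker, intervalIntegral.integral_sub hi1 hi2, intervalIntegral.integral_const_mul,
    intervalIntegral.integral_const_mul, hseries, hμ0]
  ring
end

section
/- Let 0 < ε < 1, let N be a positive integer, and let θ ∈ ℝ. Set x = (1 − ε)^N. Then | x² − x cos θ | / ( 1 + x² − 2 x cos θ ) ≤ x(1 + x)/(1 − x)² ≤ e^{−εN} (1 + e^{−εN})/(1 − e^{−εN})². In particular, the periodic-trapezoid-rule error E^N(a(1−ε), t*) = ( x² − x cos(N t*) )/( 1 + x² − 2 x cos(N t*) ) for the constant-density double-layer potential on the disk of radius a is O(e^{−εN}). -/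
open scoped Real

lemma abs_sq_sub_mul_div_le {x c : ℝ} (hx0 : 0 ≤ x) (hx1 : x < 1) (hc : |c| ≤ 1) :
    |x ^ 2 - x * c| / (1 + x ^ 2 - 2 * x * c) ≤ x * (1 + x) / (1 - x) ^ 2 := by
  obtain ⟨hc1, hc2⟩ := abs_le.mp hc
  have hpos : 0 < (1 - x) ^ 2 := pow_pos (sub_pos.mpr hx1) 2
  refine div_le_div₀ (by positivity) (abs_le.mpr ⟨?_, ?_⟩) hpos ?_ <;> nlinarith

lemma mul_one_add_div_one_sub_sq_le {x y : ℝ} (hx0 : 0 ≤ x) (hxy : x ≤ y) (hy1 : y < 1) :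
    x * (1 + x) / (1 - x) ^ 2 ≤ y * (1 + y) / (1 - y) ^ 2 := by
  have hy : 0 < 1 - y := sub_pos.mpr hy1
  have hy0 : 0 ≤ y := hx0.trans hxy
  gcongr

theorem ptr_error_exponential_bound
    (ε : ℝ) (hε0 : 0 < ε) (hε1 : ε < 1) (N : ℕ) (hN : 0 < N) (θ : ℝ) :
    |((1 - ε) ^ N) ^ 2 - (1 - ε) ^ N * Real.cos θ|
        / (1 + ((1 - ε) ^ N) ^ 2 - 2 * (1 - ε) ^ N * Real.cos θ)
      ≤ (1 - ε) ^ N * (1 + (1 - ε) ^ N) / (1 - (1 - ε) ^ N) ^ 2 ∧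
    (1 - ε) ^ N * (1 + (1 - ε) ^ N) / (1 - (1 - ε) ^ N) ^ 2
      ≤ Real.exp (-ε * N) * (1 + Real.exp (-ε * N)) / (1 - Real.exp (-ε * N)) ^ 2 := by
  have hbase : 0 ≤ 1 - ε := (sub_pos.mpr hε1).le
  have hx0 : 0 ≤ (1 - ε) ^ N := pow_nonneg hbase N
  have hxy : (1 - ε) ^ N ≤ Real.exp (-ε * N) := by
    rw [mul_comm, Real.exp_nat_mul]
    exact pow_le_pow_left₀ hbase (Real.one_sub_le_exp_neg ε) N
  have hy1 : Real.exp (-ε * N) < 1 :=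
    Real.exp_lt_one_iff.mpr (mul_neg_of_neg_of_pos (neg_lt_zero.mpr hε0) (Nat.cast_pos.mpr hN))
  exact ⟨abs_sq_sub_mul_div_le hx0 (hxy.trans_lt hy1) (Real.abs_cos_le_one θ),
    mul_one_add_div_one_sub_sq_le hx0 hxy hy1⟩
end

section
/- Let c ∈ ℝ with 0 < |c| < 1 and set ρ = (√(1 − c²) − 1)/c, so |ρ| < 1. Then for every n ∈ ℤ, (1/(2π)) ∫₀^{2π} e^{−int}/(1 + c cos t) dt = ((1 + ρ²)/(1 − ρ²)) ρ^{|n|}. -/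
open Complex
open scoped Real

/-- On the unit circle, the Poisson kernel at a real point `ρ` is
`(1 - ρ²) / (1 - 2ρ cos t + ρ²)`. -/
lemma poissonKernel_zero_ofReal_circleMap (ρ t : ℝ) :
    poissonKernel 0 (ρ : ℂ) (circleMap 0 1 t) =
      (1 - ρ ^ 2) / (1 + ρ ^ 2 - 2 * ρ * Real.cos t) := by
  have h : ‖circleMap 0 1 t - ρ‖ ^ 2 = 1 + ρ ^ 2 - 2 * ρ * Real.cos t := by
    rw [← Complex.normSq_eq_norm_sq, Complex.normSq_apply]
    simp [circleMap, Complex.exp_ofReal_mul_I_re, Complex.exp_ofReal_mul_I_im]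
    nlinarith [Real.sin_sq_add_cos_sq t]
  simp [poissonKernel, h]

/-- The Fourier coefficients of nonpositive index of the Poisson kernel. -/
lemma integral_exp_mul_poissonKernel (ρ : ℝ) (hρ : |ρ| < 1) (m : ℕ) :
    ∫ t in (0 : ℝ)..(2 * π),
      Complex.exp (Complex.I * m * t) / ((1 + ρ ^ 2 - 2 * ρ * Real.cos t : ℝ) : ℂ) =
        2 * π * ((ρ : ℂ) ^ m / (1 - (ρ : ℂ) ^ 2)) := by
  have hf : DiffContOnCl ℂ (fun z : ℂ ↦ z ^ m) (Metric.ball 0 1) :=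
    Differentiable.diffContOnCl (by fun_prop)
  have key := hf.circleAverage_poissonKernel_smul (w := (ρ : ℂ)) (by simpa using hρ)
  have hne : (1 - (ρ : ℂ) ^ 2) ≠ 0 := by
    have : 1 - ρ ^ 2 ≠ 0 := by
      have := (sq_lt_one_iff_abs_lt_one ρ).2 hρ
      linarith
    exact_mod_cast this
  have hπ : (π : ℂ) ≠ 0 := by exact_mod_cast Real.pi_ne_zero
  rw [Real.circleAverage_def] at key
  have hint : ∀ t : ℝ, (poissonKernel 0 (ρ : ℂ) • fun z : ℂ ↦ z ^ m) (circleMap 0 1 t) =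
      (1 - (ρ : ℂ) ^ 2) * (Complex.exp (Complex.I * m * t) /
        ((1 + ρ ^ 2 - 2 * ρ * Real.cos t : ℝ) : ℂ)) := by
    intro t
    rw [Pi.smul_apply', poissonKernel_zero_ofReal_circleMap, Complex.real_smul]
    have : circleMap 0 1 t ^ m = Complex.exp (Complex.I * m * t) := by
      rw [circleMap, zero_add, ofReal_one, one_mul, ← Complex.exp_nat_mul]
      ring_nf
    rw [this]
    push_cast
    ring
  simp only [hint, intervalIntegral.integral_const_mul, Complex.real_smul] at key
  rw [← key]
  push_cast
  field_simp

/-- If `g` is symmetric about `π`, the coefficients of `1 / g` at `m` and `-m` agree. -/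
lemma integral_exp_neg_div_of_symm (m : ℕ) (g : ℝ → ℂ) (hg : ∀ t, g (2 * π - t) = g t) :
    ∫ t in (0 : ℝ)..(2 * π), Complex.exp (-Complex.I * m * t) / g t =
      ∫ t in (0 : ℝ)..(2 * π), Complex.exp (Complex.I * m * t) / g t := by
  have h := intervalIntegral.integral_comp_sub_left (a := 0) (b := 2 * π)
    (fun t : ℝ ↦ Complex.exp (Complex.I * m * t) / g t) (2 * π)
  rw [sub_self, sub_zero] at h
  rw [← h]
  congr 1 with t
  rw [hg]
  congr 1
  rw [Complex.exp_eq_exp_iff_exists_int]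
  refine ⟨-m, ?_⟩
  push_cast
  ring

/-- Fourier coefficients of the Poisson kernel, up to normalisation. -/
lemma integral_exp_neg_int_mul_poissonKernel (ρ : ℝ) (hρ : |ρ| < 1) (n : ℤ) :
    ∫ t in (0 : ℝ)..(2 * π),
      Complex.exp (-Complex.I * n * t) / ((1 + ρ ^ 2 - 2 * ρ * Real.cos t : ℝ) : ℂ) =
        2 * π * ((ρ : ℂ) ^ n.natAbs / (1 - (ρ : ℂ) ^ 2)) := by
  rw [← integral_exp_mul_poissonKernel ρ hρ]
  obtain ⟨m, rfl | rfl⟩ := n.eq_nat_or_neg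
  · simp only [Int.cast_natCast, Int.natAbs_natCast]
    exact integral_exp_neg_div_of_symm m
      (fun t ↦ ((1 + ρ ^ 2 - 2 * ρ * Real.cos t : ℝ) : ℂ))
      (fun t ↦ by rw [Real.cos_two_pi_sub])
  · simp only [Int.cast_neg, Int.cast_natCast, Int.natAbs_neg, Int.natAbs_natCast, neg_mul_neg]

theorem fourier_coefficients_reciprocal_trig
    (c : ℝ) (hc0 : 0 < |c|) (hc1 : |c| < 1)
    (ρ : ℝ) (hρ : ρ = (Real.sqrt (1 - c ^ 2) - 1) / c) :
    |ρ| < 1 ∧ ∀ n : ℤ,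
      (1 / (2 * π) : ℂ) * ∫ t in (0 : ℝ)..(2 * π),
          Complex.exp (-Complex.I * n * t) / ((1 + c * Real.cos t : ℝ) : ℂ)
        = ((1 + (ρ : ℂ) ^ 2) / (1 - (ρ : ℂ) ^ 2)) * (ρ : ℂ) ^ n.natAbs := by
  have hc : c ≠ 0 := abs_pos.1 hc0
  have hc2 : c ^ 2 < 1 := (sq_lt_one_iff_abs_lt_one c).2 hc1
  have hcpos : 0 < c ^ 2 := by positivity
  set s := Real.sqrt (1 - c ^ 2) with hs
  have hs2 : s ^ 2 = 1 - c ^ 2 := Real.sq_sqrt (by linarith)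
  have hs0 : 0 < s := Real.sqrt_pos.2 (by linarith)
  have hs1 : s < 1 := by nlinarith
  have hρc : ρ * c = s - 1 := by rw [hρ]; field_simp
  have hcρ : c * (1 + ρ ^ 2) = -2 * ρ := by
    apply mul_right_cancel₀ hc
    linear_combination (2 + ρ * c + s - 1) * hρc + hs2
  have hρ1 : |ρ| < 1 := by
    rw [← sq_lt_one_iff_abs_lt_one]
    have : ρ ^ 2 * c ^ 2 = (s - 1) ^ 2 := by rw [← hρc]; ring
    by_contra! h
    nlinarith
  refine ⟨hρ1, fun n ↦ ?_⟩
  have hpos : (1 + (ρ : ℂ) ^ 2) ≠ 0 := by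
    have : 1 + ρ ^ 2 ≠ 0 := by positivity
    exact_mod_cast this
  have hπ : (π : ℂ) ≠ 0 := by exact_mod_cast Real.pi_ne_zero
  have hint : ∀ t : ℝ, Complex.exp (-Complex.I * n * t) / ((1 + c * Real.cos t : ℝ) : ℂ) =
      (1 + (ρ : ℂ) ^ 2) * (Complex.exp (-Complex.I * n * t) /
        ((1 + ρ ^ 2 - 2 * ρ * Real.cos t : ℝ) : ℂ)) := by
    intro t
    have : 1 + ρ ^ 2 - 2 * ρ * Real.cos t = (1 + ρ ^ 2) * (1 + c * Real.cos t) := by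
      linear_combination -Real.cos t * hcρ
    rw [this, Complex.ofReal_mul, ← mul_div_assoc]
    push_cast
    rw [mul_div_mul_left _ _ hpos]
  simp only [hint, intervalIntegral.integral_const_mul]
  rw [integral_exp_neg_int_mul_poissonKernel ρ hρ1]
  field_simp
end
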